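/- Let 0 ≤ β ≤ α < 1/q, 1 < r ≤ ∞ and 0 < q < ∞, and assume α + β > 2/q − 1/2 and α + 2β = 3/q − 1/r′. If there exists C > 0 such that ‖R*_{α,β}F‖_{L^q(ℝ²)} ≤ C · ‖F‖_{L^r(S¹)} for all measurable F : ℝ → ℂ, then q ≥ r (i.e. 1/q ≤ 1/r). -/

import Mathlib

open MeasureTheory Real Set Filter
open scoped ENNReal

noncomputable section

/-- Fourier extension operator of the unit circle,
`(R*F)(x,y) = (1/(2π)) ∫_0^{2π} F(φ) exp(i(x cos φ + y sin φ)) dφ`. -/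
def Rext (F : ℝ → ℂ) (x y : ℝ) : ℂ :=
  Complex.ofReal (1 / (2 * π)) *
    ∫ φ in (0:ℝ)..(2 * π),
      F φ * Complex.exp (Complex.I * Complex.ofReal (x * Real.cos φ + y * Real.sin φ))

/-- Weighted extension operator with product weight `(1+|x|)^{-α}(1+|y|)^{-β}`. -/
def Rab (α β : ℝ) (F : ℝ → ℂ) (x y : ℝ) : ℂ :=
  Rext F x y * Complex.ofReal ((1 + |x|) ^ (-α) * (1 + |y|) ^ (-β))

/-- Weighted extension operator with weight `(1+|x|+|y|)^{-γ}`. -/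
def Rgamma (γ : ℝ) (F : ℝ → ℂ) (x y : ℝ) : ℂ :=
  Rext F x y * Complex.ofReal ((1 + |x| + |y|) ^ (-γ))

/-- `L^r` norm on the circle, parametrized by `[0, 2π]`. -/
def circleLp (r : ℝ≥0∞) (F : ℝ → ℂ) : ℝ≥0∞ :=
  eLpNorm F r (volume.restrict (Ioc (0:ℝ) (2 * π)))

/-- `L^q` quasinorm on the plane. -/
def planeLp (q : ℝ≥0∞) (g : ℝ × ℝ → ℂ) : ℝ≥0∞ :=
  eLpNorm g q (volume : Measure (ℝ × ℝ))

/-- Weak `L^q` quasinorm on the line. -/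
def wline (q : ℝ) (g : ℝ → ℂ) : ℝ≥0∞ :=
  ⨆ (t : ℝ) (_ : 0 < t), ENNReal.ofReal t * (volume {x : ℝ | t < ‖g x‖}) ^ (1 / q)

/-- Weak `L^q` quasinorm on the line, for `ℝ≥0∞`-valued functions. -/
def wlineE (q : ℝ) (g : ℝ → ℝ≥0∞) : ℝ≥0∞ :=
  ⨆ (t : ℝ) (_ : 0 < t), ENNReal.ofReal t * (volume {x : ℝ | ENNReal.ofReal t < g x}) ^ (1 / q)

/-- Mixed weak quasinorm `L^{q,∞}_x(L^{q,∞}_y)`. -/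
def mixedXY (q : ℝ) (g : ℝ × ℝ → ℂ) : ℝ≥0∞ :=
  wlineE q fun x => wline q fun y => g (x, y)

/-- Mixed weak quasinorm `L^{q,∞}_y(L^{q,∞}_x)`. -/
def mixedYX (q : ℝ) (g : ℝ × ℝ → ℂ) : ℝ≥0∞ :=
  wlineE q fun y => wline q fun x => g (x, y)

/-- Weak `L^q` quasinorm on the plane. -/
def wplane (q : ℝ) (g : ℝ × ℝ → ℂ) : ℝ≥0∞ :=
  ⨆ (t : ℝ) (_ : 0 < t), ENNReal.ofReal t * (volume {p : ℝ × ℝ | t < ‖g p‖}) ^ (1 / q)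

/-- Lorentz `L^{r,1}` norm on the circle. -/
def lorentz1 (r : ℝ) (F : ℝ → ℂ) : ℝ≥0∞ :=
  ∫⁻ t in Ioi (0:ℝ), (volume {φ ∈ Icc (0:ℝ) (2 * π) | t < ‖F φ‖}) ^ (1 / r)

/-- Weak `L^r` quasinorm on the circle. -/
def wcircle (r : ℝ) (F : ℝ → ℂ) : ℝ≥0∞ :=
  ⨆ (t : ℝ) (_ : 0 < t), ENNReal.ofReal t * (volume {φ ∈ Icc (0:ℝ) (2 * π) | t < ‖F φ‖}) ^ (1 / r)

def bI (k : ℕ) : Set ℝ := Ioc (π/2 + (1/2:ℝ)^(k+1)) (π/2 + (1/2:ℝ)^k)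

def bf (ρ : ℝ) (k : ℕ) : ℝ → ℂ := (bI k).indicator (fun _ => (((2:ℝ)^((k:ℝ)*ρ) : ℝ) : ℂ))

def bE (k : ℕ) : Set (ℝ × ℝ) := Ioc ((2:ℝ)^k/4) ((2:ℝ)^k/2) ×ˢ Ioc (0:ℝ) ((4:ℝ)^k/2)

lemma bI_sub (k : ℕ) : bI k ⊆ Ioc 0 (2*π) := by
  intro φ hφ
  have h1 : (1/2:ℝ)^k ≤ 1 := pow_le_one₀ (by norm_num) (by norm_num)
  have h2 : (0:ℝ) < (1/2:ℝ)^(k+1) := by positivity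
  have := Real.pi_gt_three
  exact ⟨by linarith [hφ.1], by linarith [hφ.2]⟩

lemma bI_disj {j k : ℕ} {φ : ℝ} (hj : φ ∈ bI j) (hk : φ ∈ bI k) : j = k := by
  have key : ∀ {j k : ℕ}, φ ∈ bI j → φ ∈ bI k → ¬ j < k := by
    intro j k hj hk hlt
    have : (1/2:ℝ)^k ≤ (1/2:ℝ)^(j+1) := pow_le_pow_of_le_one (by norm_num) (by norm_num) hlt
    linarith [hj.1, hk.2]
  exact le_antisymm (not_lt.1 (key hk hj)) (not_lt.1 (key hj hk))

lemma bE_disj {j k : ℕ} {p : ℝ × ℝ} (hj : p ∈ bE j) (hk : p ∈ bE k) : j = k := by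
  have key : ∀ {j k : ℕ}, p ∈ bE j → p ∈ bE k → ¬ j < k := by
    intro j k hj hk hlt
    have : (2:ℝ)^(j+1) ≤ (2:ℝ)^k := pow_le_pow_right₀ (by norm_num) hlt
    rw [pow_succ] at this
    linarith [hj.1.2, hk.1.1]
  exact le_antisymm (not_lt.1 (key hk hj)) (not_lt.1 (key hj hk))

lemma measurable_bI (k : ℕ) : MeasurableSet (bI k) := measurableSet_Ioc

lemma measurable_bf (ρ : ℝ) (k : ℕ) : Measurable (bf ρ k) :=
  measurable_const.indicator (measurable_bI k)

lemma measurable_Rab (α β : ℝ) (F : ℝ → ℂ) (hF : Measurable F) :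
    Measurable (fun p : ℝ × ℝ => Rab α β F p.1 p.2) := by
  unfold Rab Rext
  have h : StronglyMeasurable (fun p : ℝ × ℝ => ∫ φ in (0:ℝ)..(2 * π),
      F φ * Complex.exp (Complex.I * Complex.ofReal (p.1 * Real.cos φ + p.2 * Real.sin φ))) := by
    simp only [intervalIntegral.integral_of_le Real.two_pi_pos.le]
    apply StronglyMeasurable.integral_prod_right (f := fun (p : ℝ × ℝ) φ => F φ * Complex.exp (Complex.I * Complex.ofReal (p.1 * Real.cos φ + p.2 * Real.sin φ)))
    apply Measurable.stronglyMeasurable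
    unfold Function.uncurry
    fun_prop
  have := h.measurable
  fun_prop

lemma bint (ρ : ℝ) (k : ℕ) (x y : ℝ) : IntervalIntegrable (fun φ => bf ρ k φ * Complex.exp (Complex.I * Complex.ofReal (x * Real.cos φ + y * Real.sin φ))) volume 0 (2*π) := by
  have : (fun φ => bf ρ k φ * Complex.exp (Complex.I * Complex.ofReal (x * Real.cos φ + y * Real.sin φ))) = (bI k).indicator (fun φ => (((2:ℝ)^((k:ℝ)*ρ) : ℝ) : ℂ) * Complex.exp (Complex.I * Complex.ofReal (x * Real.cos φ + y * Real.sin φ))) := by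
    ext φ
    by_cases h : φ ∈ bI k <;> simp [bf, h]
  rw [this, intervalIntegrable_iff]
  apply Integrable.indicator _ (measurable_bI k)
  rw [← IntegrableOn, ← intervalIntegrable_iff]
  apply Continuous.intervalIntegrable
  fun_prop

lemma Rab_sum (α β ρ : ℝ) (M : ℕ) (e : Fin M → ℂ) (x y : ℝ) :
    Rab α β (fun φ => ∑ k : Fin M, e k * bf ρ k φ) x y = ∑ k : Fin M, e k * Rab α β (bf ρ k) x y := by
  unfold Rab Rext
  have : ∀ φ : ℝ, (∑ k : Fin M, e k * bf ρ k φ) * Complex.exp (Complex.I * Complex.ofReal (x * Real.cos φ + y * Real.sin φ)) = ∑ k : Fin M, e k * (bf ρ k φ * Complex.exp (Complex.I * Complex.ofReal (x * Real.cos φ + y * Real.sin φ))) := by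
    intro φ
    rw [Finset.sum_mul]
    exact Finset.sum_congr rfl fun _ _ => by ring
  simp_rw [this]
  rw [intervalIntegral.integral_finsetSum]
  · simp only [intervalIntegral.integral_const_mul]
    rw [Finset.mul_sum, Finset.sum_mul]
    exact Finset.sum_congr rfl fun _ _ => by ring
  · intro i _
    exact (bint ρ i x y).const_mul _

lemma phase_bd (k : ℕ) (x y φ : ℝ) (h : (x, y) ∈ bE k) (hφ : φ ∈ bI k) :
    |x * Real.cos φ + y * Real.sin φ - y| ≤ 3/4 := by
  obtain ⟨⟨hx1, hx2⟩, hy1, hy2⟩ := h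
  simp only at hx1 hx2 hy1 hy2
  obtain ⟨s, rfl⟩ : ∃ s, φ = s + π/2 := ⟨φ - π/2, by ring⟩
  obtain ⟨h1, h2⟩ := hφ
  rw [Real.cos_add_pi_div_two, Real.sin_add_pi_div_two]
  have hs0 : 0 < s := by have : (0:ℝ) < (1/2)^(k+1) := by positivity
                         linarith
  have hs1 : s ≤ (1/2)^k := by linarith
  have hx0 : 0 < x := lt_trans (by positivity) hx1
  have a1 : |Real.sin s| ≤ s := by
    have := Real.abs_sin_le_abs (x := s)
    rwa [abs_of_pos hs0] at this
  have a2 := Real.one_sub_sq_div_two_le_cos (x := s)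
  have a3 := Real.cos_le_one s
  have e1 : (2:ℝ)^k * (1/2)^k = 1 := by rw [← mul_pow]; norm_num
  have e2 : (4:ℝ)^k * ((1/2)^k)^2 = 1 := by rw [← pow_mul, mul_comm k 2, pow_mul, ← mul_pow]; norm_num
  have b1 : x * s ≤ 1/2 := by
    calc x * s ≤ (2^k/2) * (1/2)^k := by gcongr
      _ = 1/2 := by linarith
  have b2 : y * s^2 ≤ 1/2 := by
    calc y * s^2 ≤ (4^k/2) * ((1/2)^k)^2 := by gcongr
      _ = 1/2 := by linarith
  have b3 : |x * Real.sin s| ≤ 1/2 := by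
    rw [abs_mul, abs_of_pos hx0]
    exact le_trans (by gcongr) b1
  have b4 : y * (1 - Real.cos s) ≤ 1/4 := by
    have : y * (1 - Real.cos s) ≤ y * (s^2/2) := by gcongr; linarith
    linarith
  have b5 : 0 ≤ y * (1 - Real.cos s) := mul_nonneg hy1.le (by linarith)
  rw [abs_le] at *
  constructor <;> linarith [b3.1, b3.2]

lemma Rext_lower (ρ : ℝ) (k : ℕ) (x y : ℝ) (h : (x, y) ∈ bE k) :
    1 / (2*π) * ((2:ℝ)^((k:ℝ)*ρ) * ((1/2:ℝ)^k / 8)) ≤ ‖Rext (bf ρ k) x y‖ := by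
  unfold Rext
  have e0 : (∫ φ in (0:ℝ)..(2 * π),
      bf ρ k φ * Complex.exp (Complex.I * Complex.ofReal (x * Real.cos φ + y * Real.sin φ)))
      = (((2:ℝ)^((k:ℝ)*ρ) : ℝ) : ℂ) * ∫ φ in (π/2 + (1/2:ℝ)^(k+1))..(π/2 + (1/2:ℝ)^k), Complex.exp (Complex.I * Complex.ofReal (x * Real.cos φ + y * Real.sin φ)) := by
    have : (fun φ => bf ρ k φ * Complex.exp (Complex.I * Complex.ofReal (x * Real.cos φ + y * Real.sin φ))) = (bI k).indicator (fun φ => (((2:ℝ)^((k:ℝ)*ρ) : ℝ) : ℂ) * Complex.exp (Complex.I * Complex.ofReal (x * Real.cos φ + y * Real.sin φ))) := by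
      ext φ
      by_cases h : φ ∈ bI k <;> simp [bf, h]
    rw [this, intervalIntegral.integral_of_le Real.two_pi_pos.le, setIntegral_indicator (measurable_bI k), inter_eq_right.2 (bI_sub k), ← intervalIntegral.integral_const_mul, intervalIntegral.integral_of_le, bI]
    have : (1/2:ℝ)^(k+1) ≤ (1/2:ℝ)^k := pow_le_pow_of_le_one (by norm_num) (by norm_num) (by omega)
    linarith
  rw [e0, norm_mul, norm_mul, Complex.norm_real, Complex.norm_real, Real.norm_of_nonneg (by positivity), Real.norm_of_nonneg (by positivity)]
  gcongr
  set a := (π/2 + (1/2:ℝ)^(k+1)) with ha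
  set b := (π/2 + (1/2:ℝ)^k) with hb
  have hab : b - a = (1/2:ℝ)^k/2 := by rw [ha, hb, pow_succ]; ring
  have hab0 : 0 < b - a := by rw [hab]; positivity
  have hI : IntervalIntegrable (fun φ => Complex.exp (Complex.I * Complex.ofReal (x * Real.cos φ + y * Real.sin φ))) volume a b := by
    apply Continuous.intervalIntegrable
    fun_prop
  have n1 : ‖∫ φ in a..b, (Complex.exp (Complex.I * Complex.ofReal (x * Real.cos φ + y * Real.sin φ)) - Complex.exp (Complex.I * (y:ℂ)))‖ ≤ 3/4 * |b - a| := by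
    apply intervalIntegral.norm_integral_le_of_norm_le_const
    intro φ hφ
    rw [uIoc_of_le (by linarith)] at hφ
    have := phase_bd k x y φ h hφ
    have e : Complex.exp (Complex.I * Complex.ofReal (x * Real.cos φ + y * Real.sin φ)) - Complex.exp (Complex.I * (y:ℂ)) = Complex.exp (Complex.I * (y:ℂ)) * (Complex.exp (Complex.I * ((x * Real.cos φ + y * Real.sin φ - y : ℝ):ℂ)) - 1) := by
      rw [mul_sub, ← Complex.exp_add, mul_one]
      congr 2
      push_cast
      ring
    rw [e, norm_mul, mul_comm Complex.I (y:ℂ), Complex.norm_exp_ofReal_mul_I, one_mul]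
    exact (Real.norm_exp_I_mul_ofReal_sub_one_le).trans this
  rw [intervalIntegral.integral_sub hI (by simp), intervalIntegral.integral_const, abs_of_pos hab0] at n1
  have n2 : ‖(b - a) • Complex.exp (Complex.I * (y:ℂ))‖ = b - a := by
    rw [norm_smul, mul_comm Complex.I (y:ℂ), Complex.norm_exp_ofReal_mul_I, Real.norm_of_nonneg hab0.le, mul_one]
  have n3 := norm_sub_norm_le ((b - a) • Complex.exp (Complex.I * (y:ℂ))) (∫ φ in a..b, Complex.exp (Complex.I * Complex.ofReal (x * Real.cos φ + y * Real.sin φ)))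
  rw [norm_sub_rev, n2] at n3
  linarith

lemma Rab_lower (α β ρ : ℝ) (hβ0 : 0 ≤ β) (hα : 0 ≤ α) (k : ℕ) (x y : ℝ) (h : (x, y) ∈ bE k) :
    (1/(16*π) * 2^(-α-β)) * (2:ℝ)^((k:ℝ)*(ρ - 1 - α - 2*β)) ≤ ‖Rab α β (bf ρ k) x y‖ := by
  unfold Rab
  have hR := Rext_lower ρ k x y h
  obtain ⟨⟨hx1, hx2⟩, hy1, hy2⟩ := h
  simp only at hx1 hx2 hy1 hy2
  have hx0 : 0 < x := lt_trans (by positivity) hx1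
  have w1 : ((2:ℝ) * 2^k)^(-α) ≤ (1+|x|)^(-α) := by
    apply Real.rpow_le_rpow_of_nonpos (by positivity) _ (by linarith)
    rw [abs_of_pos hx0]
    linarith [one_le_pow₀ (n := k) (show (1:ℝ) ≤ 2 by norm_num)]
  have w2 : ((2:ℝ) * 4^k)^(-β) ≤ (1+|y|)^(-β) := by
    apply Real.rpow_le_rpow_of_nonpos (by positivity) _ (by linarith)
    rw [abs_of_pos hy1]
    linarith [one_le_pow₀ (n := k) (show (1:ℝ) ≤ 4 by norm_num)]
  rw [norm_mul, Complex.norm_real, Real.norm_of_nonneg (by positivity)]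
  have : (1/(16*π) * 2^(-α-β)) * (2:ℝ)^((k:ℝ)*(ρ - 1 - α - 2*β)) = (1 / (2*π) * ((2:ℝ)^((k:ℝ)*ρ) * ((1/2:ℝ)^k / 8))) * (((2:ℝ) * 2^k)^(-α) * ((2:ℝ) * 4^k)^(-β)) := by
    have f1 : (1/2:ℝ)^k = (2:ℝ)^(-(k:ℝ)) := by
      rw [Real.rpow_neg (by norm_num), Real.rpow_natCast, one_div, inv_pow]
    have f2 : (2:ℝ) * 2^k = (2:ℝ)^(1+(k:ℝ)) := by
      rw [Real.rpow_add (by norm_num), Real.rpow_natCast, Real.rpow_one]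
    have f3 : (2:ℝ) * 4^k = (2:ℝ)^(1+2*(k:ℝ)) := by
      rw [Real.rpow_add (by norm_num), Real.rpow_mul (by norm_num), Real.rpow_natCast, Real.rpow_one]
      norm_num
    rw [f1, f2, f3, ← Real.rpow_mul (by norm_num), ← Real.rpow_mul (by norm_num)]
    have : ∀ A B D E G : ℝ, 1 / (2*π) * ((2:ℝ)^A * (2^B/8)) * (2^D*2^E) = 1/(16*π) * (2:ℝ)^(A+B+D+E) := by
      intro A B D E G
      rw [Real.rpow_add (by norm_num), Real.rpow_add (by norm_num), Real.rpow_add (by norm_num)]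
      field_simp
      norm_num
    rw [this _ _ _ _ 0, mul_assoc, ← Real.rpow_add (by norm_num)]
    congr 2
    ring
  rw [this]
  gcongr

lemma F_pt (ρ : ℝ) (M : ℕ) (e : Fin M → ℂ) (he : ∀ k, ‖e k‖ ≤ 1) (φ : ℝ) :
    (∑ k : Fin M, e k * bf ρ k φ = 0) ∨
    ∃ k : Fin M, φ ∈ bI k ∧ ‖∑ k : Fin M, e k * bf ρ k φ‖ ≤ (2:ℝ)^((k:ℝ)*ρ) := by
  by_cases h : ∃ k : Fin M, φ ∈ bI k
  · right
    obtain ⟨k, hk⟩ := h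
    refine ⟨k, hk, ?_⟩
    rw [Finset.sum_eq_single k]
    · simp only [bf, indicator_of_mem hk]
      rw [norm_mul, Complex.norm_real, Real.norm_of_nonneg (by positivity)]
      exact mul_le_of_le_one_left (by positivity) (he k)
    · intro j _ hj
      have : φ ∉ bI j := fun hj' => hj (Fin.ext (bI_disj hj' hk))
      simp [bf, this]
    · simp
  · left
    push Not at h
    exact Finset.sum_eq_zero fun k _ => by simp [bf, h k]

lemma circle_bd (r : ℝ≥0∞) (hr : 1 < r) (M : ℕ) (hM : 1 ≤ M) (e : Fin M → ℂ) (he : ∀ k, ‖e k‖ ≤ 1) :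
    circleLp r (fun φ => ∑ k : Fin M, e k * bf r⁻¹.toReal k φ) ≤ ENNReal.ofReal ((M:ℝ)^(r⁻¹.toReal)) := by
  unfold circleLp
  by_cases hrt : r = ⊤
  · subst hrt
    simp only [ENNReal.inv_top, ENNReal.toReal_zero, Real.rpow_zero, eLpNorm_exponent_top]
    apply eLpNormEssSup_le_of_ae_bound
    refine Eventually.of_forall fun φ => ?_
    rcases F_pt 0 M e he φ with h | ⟨k, _, h⟩
    · rw [h]; simp
    · simpa using h
  · set p := r.toReal with hp
    have hp0 : 0 < p := ENNReal.toReal_pos (by positivity) hrt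
    have hρ : r⁻¹.toReal = p⁻¹ := ENNReal.toReal_inv r
    rw [eLpNorm_eq_lintegral_rpow_enorm_toReal (by positivity) hrt, ← hp, hρ, one_div, ← ENNReal.ofReal_rpow_of_nonneg (by positivity) (by positivity)]
    gcongr
    calc ∫⁻ φ in Ioc 0 (2*π), ‖∑ k : Fin M, e k * bf p⁻¹ k φ‖ₑ ^ p
        ≤ ∫⁻ φ in Ioc 0 (2*π), ∑ k : Fin M, (bI k).indicator (fun _ => ENNReal.ofReal ((2:ℝ)^(k:ℕ))) φ := by
          apply lintegral_mono
          intro φ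
          simp only
          rcases F_pt p⁻¹ M e he φ with h | ⟨k, hk, h⟩
          · rw [h]; simp [hp0]
          · refine le_trans ?_ (Finset.single_le_sum (fun _ _ => zero_le) (Finset.mem_univ k))
            rw [indicator_of_mem hk, ← ofReal_norm, ENNReal.ofReal_rpow_of_nonneg (by positivity) hp0.le]
            apply ENNReal.ofReal_le_ofReal
            calc _ ≤ ((2:ℝ)^(((k:ℕ):ℝ)*p⁻¹))^p := by gcongr
              _ = _ := by rw [← Real.rpow_mul (by norm_num), inv_mul_cancel_right₀ hp0.ne', Real.rpow_natCast]
      _ ≤ ∑ k : Fin M, 1 := by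
          rw [lintegral_finsetSum Finset.univ (f := fun (k : Fin M) φ => (bI k).indicator (fun _ => ENNReal.ofReal ((2:ℝ)^(k:ℕ))) φ) fun k _ => measurable_const.indicator (measurable_bI k)]
          apply Finset.sum_le_sum
          intro k _
          rw [lintegral_indicator (measurable_bI k), setLIntegral_const]
          calc _ ≤ ENNReal.ofReal ((2:ℝ)^(k:ℕ)) * volume (bI k) := by
                gcongr; exact Measure.restrict_le_self
            _ ≤ 1 := by
              rw [bI, Real.volume_Ioc, ← ENNReal.ofReal_mul (by positivity)]
              apply ENNReal.ofReal_le_one.2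
              have e1 : (2:ℝ)^(k:ℕ) * (1/2)^(k:ℕ) = 1 := by rw [← mul_pow]; norm_num
              rw [pow_succ]
              linarith
      _ = ENNReal.ofReal (M:ℝ) := by simp

lemma measurable_bE (k : ℕ) : MeasurableSet (bE k) := measurableSet_Ioc.prod measurableSet_Ioc

lemma vol_bE (k : ℕ) : volume (bE k) = ENNReal.ofReal ((8:ℝ)^k / 8) := by
  rw [bE, Measure.volume_eq_prod, Measure.prod_prod, Real.volume_Ioc, Real.volume_Ioc, ← ENNReal.ofReal_mul]
  · congr 1
    rw [show (8:ℝ) = 2 * 4 by norm_num, mul_pow]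
    ring
  · have : (0:ℝ) < 2^k := by positivity
    linarith

lemma block_lower (α β ρ q : ℝ) (hβ0 : 0 ≤ β) (hα : 0 ≤ α) (hq : 0 < q)
    (hend : α + 2 * β = 3 / q - (1 - ρ)) (k : ℕ) :
    ENNReal.ofReal ((1/(16*π) * 2^(-α-β))^q / 8) ≤
      ∫⁻ p in bE k, ‖Rab α β (bf ρ k) p.1 p.2‖ₑ ^ q := by
  set c := (1/(16*π) * (2:ℝ)^(-α-β)) with hc
  have hc0 : 0 < c := by positivity
  clear_value c
  calc ENNReal.ofReal (c^q / 8)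
      = ENNReal.ofReal ((c * (2:ℝ)^((k:ℝ)*(ρ - 1 - α - 2*β)))^q) * volume (bE k) := by
        rw [vol_bE, ← ENNReal.ofReal_mul (by positivity), Real.mul_rpow (by positivity) (by positivity), ← Real.rpow_mul (by norm_num)]
        congr 1
        have : (k:ℝ)*(ρ - 1 - α - 2*β) * q = (-3) * (k:ℝ) := by
          have : ρ - 1 - α - 2*β = -(3/q) := by linarith
          rw [this]; field_simp
        rw [this, Real.rpow_mul (by norm_num), Real.rpow_natCast]
        have : (2:ℝ)^(-3:ℝ) = 1/8 := by
          rw [Real.rpow_neg (by norm_num)]; norm_num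
        rw [this]
        have : (1/8:ℝ)^k * 8^k = 1 := by rw [← mul_pow]; norm_num
        linear_combination (-c^q/8) * this
    _ = ∫⁻ p in bE k, ENNReal.ofReal ((c * (2:ℝ)^((k:ℝ)*(ρ - 1 - α - 2*β)))^q) := by
        rw [setLIntegral_const]
    _ ≤ _ := by
        apply setLIntegral_mono' (measurable_bE k)
        intro p hp
        rw [← ofReal_norm, ENNReal.ofReal_rpow_of_nonneg (by positivity) hq.le]
        apply ENNReal.ofReal_le_ofReal
        gcongr
        rw [hc]
        exact Rab_lower α β ρ hβ0 hα k p.1 p.2 hp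

def bG (ρ : ℝ) (M : ℕ) (ε : Fin M → ℤˣ) : ℝ → ℂ := fun φ => ∑ k : Fin M, ((ε k : ℤ) : ℂ) * bf ρ k φ

lemma measurable_bG (ρ : ℝ) (M : ℕ) (ε : Fin M → ℤˣ) : Measurable (bG ρ M ε) := by
  unfold bG
  exact Finset.measurable_sum _ fun k _ => (measurable_bf ρ k).const_mul _

lemma flip_pt (α β ρ q : ℝ) (hq : 0 < q) (M : ℕ) (ε : Fin M → ℤˣ) (k : Fin M) (x y : ℝ) :
    ‖Rab α β (bf ρ k) x y‖ₑ ^ q ≤ ‖Rab α β (bG ρ M ε) x y‖ₑ ^ q +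
      ‖Rab α β (bG ρ M (ε * Pi.mulSingle k (-1))) x y‖ₑ ^ q := by
  have hd : Rab α β (bG ρ M ε) x y - Rab α β (bG ρ M (ε * Pi.mulSingle k (-1))) x y
      = 2 * ((ε k : ℤ) : ℂ) * Rab α β (bf ρ k) x y := by
    unfold bG
    rw [Rab_sum, Rab_sum, ← Finset.sum_sub_distrib, Finset.sum_eq_single k]
    · simp; ring
    · intro j _ hj
      simp [Pi.mulSingle_eq_of_ne hj]
    · simp
  set A := Rab α β (bG ρ M ε) x y
  set B := Rab α β (bG ρ M (ε * Pi.mulSingle k (-1))) x y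
  set T := Rab α β (bf ρ k) x y
  have hn : ‖((ε k : ℤ) : ℂ)‖ = 1 := by
    rcases Int.units_eq_one_or (ε k) with h | h <;> simp [h]
  have h2 : 2 * ‖T‖ ≤ ‖A‖ + ‖B‖ := by
    have := norm_sub_le A B
    rw [hd, norm_mul, norm_mul, hn] at this
    simpa using this
  rcases le_total ‖A‖ ‖B‖ with h | h
  · refine le_trans ?_ le_add_self
    gcongr
    rw [← ofReal_norm, ← ofReal_norm]
    exact ENNReal.ofReal_le_ofReal (by linarith)
  · refine le_trans ?_ le_self_add
    gcongr
    rw [← ofReal_norm, ← ofReal_norm]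
    exact ENNReal.ofReal_le_ofReal (by linarith)

lemma main_ineq (α β ρ q : ℝ) (hβ0 : 0 ≤ β) (hα : 0 ≤ α) (hq : 0 < q)
    (hend : α + 2 * β = 3 / q - (1 - ρ)) (M : ℕ) (B : ℝ≥0∞)
    (hB : ∀ ε : Fin M → ℤˣ, ∫⁻ p : ℝ × ℝ, ‖Rab α β (bG ρ M ε) p.1 p.2‖ₑ ^ q ≤ B) :
    (M:ℝ≥0∞) * ENNReal.ofReal ((1/(16*π) * 2^(-α-β))^q / 8) ≤ 2 * B := by
  set c := ENNReal.ofReal ((1/(16*π) * 2^(-α-β))^q / 8)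
  let J : Fin M → (Fin M → ℤˣ) → ℝ≥0∞ := fun k ε => ∫⁻ p in bE k, ‖Rab α β (bG ρ M ε) p.1 p.2‖ₑ ^ q
  have hmeas : ∀ ε : Fin M → ℤˣ, Measurable (fun p : ℝ × ℝ => ‖Rab α β (bG ρ M ε) p.1 p.2‖ₑ ^ q) := fun ε =>
    (measurable_Rab α β _ (measurable_bG ρ M ε)).enorm.pow_const q
  have h1 : ∀ k ε, c ≤ J k ε + J k (ε * Pi.mulSingle k (-1)) := by
    intro k ε
    refine (block_lower α β ρ q hβ0 hα hq hend k).trans ?_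
    rw [← lintegral_add_left (hmeas ε)]
    exact lintegral_mono fun p => flip_pt α β ρ q hq M ε k p.1 p.2
  have h2 : ∀ ε, ∑ k, J k ε ≤ B := by
    intro ε
    refine le_trans ?_ (hB ε)
    rw [show ∑ k, J k ε = ∑ k ∈ (Finset.univ : Finset (Fin M)), ∫⁻ p in bE k, ‖Rab α β (bG ρ M ε) p.1 p.2‖ₑ ^ q from rfl,
      ← lintegral_biUnion_finset]
    · exact setLIntegral_le_lintegral _ _
    · intro i _ j _ hij
      exact Set.disjoint_left.2 fun p hi hj => hij (Fin.ext (bE_disj hi hj))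
    · intro k _
      exact measurable_bE k
  have h3 : ∀ k, ∑ _ε : Fin M → ℤˣ, c ≤ 2 * ∑ ε, J k ε := by
    intro k
    calc ∑ _ε : Fin M → ℤˣ, c ≤ ∑ ε, (J k ε + J k (ε * Pi.mulSingle k (-1))) := Finset.sum_le_sum fun ε _ => h1 k ε
      _ = 2 * ∑ ε, J k ε := by
        rw [Finset.sum_add_distrib, two_mul]
        congr 1
        exact Equiv.sum_comp (Equiv.mulRight (Pi.mulSingle k (-1) : Fin M → ℤˣ)) (J k)
  have h4 : ∑ _k : Fin M, ∑ _ε : Fin M → ℤˣ, c ≤ 2 * ∑ _ε : Fin M → ℤˣ, B := by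
    calc _ ≤ ∑ k, 2 * ∑ ε, J k ε := Finset.sum_le_sum fun k _ => h3 k
      _ = 2 * ∑ ε, ∑ k, J k ε := by rw [← Finset.mul_sum, Finset.sum_comm]
      _ ≤ _ := by gcongr with ε; exact h2 ε
  simp only [Finset.sum_const, nsmul_eq_mul, Finset.card_univ] at h4
  set N : ℝ≥0∞ := ((Fintype.card (Fin M → ℤˣ) : ℕ) : ℝ≥0∞) with hN
  have hN0 : N ≠ 0 := by rw [hN]; exact_mod_cast Fintype.card_ne_zero
  have hNt : N ≠ ⊤ := ENNReal.natCast_ne_top _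
  rw [Fintype.card_fin] at h4
  rw [← ENNReal.mul_le_mul_iff_right hN0 hNt]
  calc N * (M * c) = M * (N * c) := by ring
    _ ≤ _ := h4
    _ = _ := by ring

/-- Lemma 15 (necessity of `q ≥ r` for endpoint estimates with `α < 1/q`),
with `q ≥ r` read as `1/q ≤ 1/r`. -/
theorem statement12 (α β : ℝ) (hβ0 : 0 ≤ β) (hβα : β ≤ α)
    (r : ℝ≥0∞) (hr : 1 < r) (q : ℝ) (hq : 0 < q) (hαq : α < 1 / q)
    (hsum : α + β > 2 / q - 1 / 2) (hend : α + 2 * β = 3 / q - (1 - r⁻¹.toReal))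
    (hbdd : ∃ C : ℝ, 0 < C ∧ ∀ F : ℝ → ℂ, Measurable F →
      planeLp (ENNReal.ofReal q) (fun p => Rab α β F p.1 p.2) ≤
        ENNReal.ofReal C * circleLp r F) :
    1 / q ≤ r⁻¹.toReal := by
  obtain ⟨C, hC, hF⟩ := hbdd
  set ρ := r⁻¹.toReal with hρ
  have key : ∀ M : ℕ, 1 ≤ M → (M:ℝ) * ((1/(16*π) * 2^(-α-β))^q / 8) ≤ 2 * (C * (M:ℝ)^ρ)^q := by
    intro M hM
    have := main_ineq α β ρ q hβ0 (hβ0.trans hβα) hq hend M (ENNReal.ofReal ((C * (M:ℝ)^ρ)^q)) (by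
      intro ε
      have h := (hF _ (measurable_bG ρ M ε)).trans (mul_le_mul_right (circle_bd r hr M hM (fun k => ((ε k : ℤ) : ℂ)) (by
        intro k
        rcases Int.units_eq_one_or (ε k) with h | h <;> simp [h])) _)
      rw [planeLp, eLpNorm_eq_lintegral_rpow_enorm_toReal (by simpa using hq) ENNReal.ofReal_ne_top, ENNReal.toReal_ofReal hq.le, ← ENNReal.ofReal_mul hC.le, one_div, ENNReal.rpow_inv_le_iff hq, ENNReal.ofReal_rpow_of_nonneg (by positivity) hq.le] at h
      exact h)
    rw [← ENNReal.ofReal_natCast, ← ENNReal.ofReal_mul (by positivity), show (2:ℝ≥0∞) = ENNReal.ofReal 2 by simp, ← ENNReal.ofReal_mul (by positivity), ENNReal.ofReal_le_ofReal_iff (by positivity)] at this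
    exact this
  set c := ((1/(16*π) * (2:ℝ)^(-α-β))^q / 8) with hc
  have hc0 : 0 < c := by positivity
  rw [div_le_iff₀ hq]
  by_contra! hlt
  have hT : Tendsto (fun M : ℕ => (M:ℝ)^(1 - ρ*q)) atTop atTop :=
    (tendsto_rpow_atTop (by linarith)).comp tendsto_natCast_atTop_atTop
  obtain ⟨M, hM1, hM2⟩ := ((hT.eventually_gt_atTop (2 * C^q / c)).and (eventually_ge_atTop 1)).exists
  have hk := key M hM2
  have hM0 : (0:ℝ) < M := by exact_mod_cast hM2
  rw [Real.mul_rpow hC.le (by positivity), ← Real.rpow_mul hM0.le] at hk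
  rw [Real.rpow_sub hM0, Real.rpow_one, div_lt_div_iff₀ hc0 (by positivity)] at hM1
  linarith
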